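/- For all integers i ≥ 2 and j ≥ 1, the following identity of rational numbers holds: ∑_{m=0}^{j} ((−1)^m B_m/m!) · ((−1)^{j+1−m}/(j+1−m)!) · ∑_{p=1}^{j+1−m} c_{(j+1−m,p)}/(i−1+p) = ((−1)^j/j!) · ∑_{p=1}^{j} c_{(j,p)}/(i+p). -/

import Mathlib

open Finset

/-- `c m p := ∑_{q=1}^{p} (-1)^q (p choose q) q^m`. -/
def c (m p : ℕ) : ℚ :=
  ∑ q ∈ Finset.Icc 1 p, (-1 : ℚ) ^ q * (p.choose q : ℚ) * (q : ℚ) ^ m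

open PowerSeries in
/-- The power series `1 - e^{-t}`. -/
noncomputable def oneSubExpNeg : PowerSeries ℚ := 1 - rescale (-1 : ℚ) (exp ℚ)

open PowerSeries in
theorem X_dvd_oneSubExpNeg : (X : PowerSeries ℚ) ∣ oneSubExpNeg := by
  rw [X_dvd_iff, ← coeff_zero_eq_constantCoeff_apply]
  simp [oneSubExpNeg, coeff_rescale, coeff_exp, -coeff_zero_eq_constantCoeff]

open PowerSeries in
theorem coeff_oneSubExpNeg_pow_of_lt {n p : ℕ} (h : n < p) :
    coeff n (oneSubExpNeg ^ p) = 0 :=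
  X_pow_dvd_iff.mp (pow_dvd_pow_of_dvd X_dvd_oneSubExpNeg p) n h

open PowerSeries in
theorem coeff_oneSubExpNeg_pow {n : ℕ} (hn : n ≠ 0) (p : ℕ) :
    coeff n (oneSubExpNeg ^ p) = (-1 : ℚ) ^ n / (n.factorial : ℚ) * c n p := by
  have hterm (q : ℕ) : coeff n ((-rescale (-1 : ℚ) (exp ℚ)) ^ q * 1 ^ (p - q) * (p.choose q : ℚ⟦X⟧))
      = (-1 : ℚ) ^ n / (n.factorial : ℚ) * ((-1 : ℚ) ^ q * (p.choose q : ℚ) * (q : ℚ) ^ n) := by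
    have : (-rescale (-1 : ℚ) (exp ℚ)) ^ q * 1 ^ (p - q) * (p.choose q : ℚ⟦X⟧)
        = C ((-1 : ℚ) ^ q * (p.choose q : ℚ)) * rescale (-1 : ℚ) (rescale (q : ℚ) (exp ℚ)) := by
      rw [neg_pow, ← map_pow, exp_pow_eq_rescale_exp]
      simp only [map_mul, map_pow, map_neg, map_one, map_natCast]
      ring
    rw [this, coeff_C_mul, coeff_rescale, coeff_rescale, coeff_exp]
    simp only [eq_ratCast, Rat.cast_id]
    ring
  rw [oneSubExpNeg, sub_eq_neg_add, add_pow, map_sum, Finset.sum_congr rfl fun q _ => hterm q,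
    ← Finset.mul_sum, c, Finset.range_eq_Ico, Finset.sum_eq_sum_Ico_succ_bot (Nat.succ_pos p)]
  simp [hn, Finset.Ico_add_one_right_eq_Icc]

open PowerSeries in
theorem bernoulli'PowerSeries_mul_oneSubExpNeg :
    bernoulli'PowerSeries ℚ * oneSubExpNeg = X := by
  have h := bernoulli'PowerSeries_mul_exp_sub_one ℚ
  have he : exp ℚ * rescale (-1 : ℚ) (exp ℚ) = 1 := exp_mul_exp_neg_eq_one
  calc bernoulli'PowerSeries ℚ * oneSubExpNeg
      = bernoulli'PowerSeries ℚ * (exp ℚ - 1) * rescale (-1 : ℚ) (exp ℚ) := by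
        rw [oneSubExpNeg]; linear_combination -bernoulli'PowerSeries ℚ * he
    _ = X := by rw [h]; linear_combination X * he

open PowerSeries in
/-- The range of summation over `p` may be enlarged, as the extra terms vanish. -/
theorem sum_c_div_eq_sum_coeff {n N : ℕ} (hn : n ≠ 0) (h : n ≤ N) (f : ℕ → ℚ) :
    (-1 : ℚ) ^ n / (n.factorial : ℚ) * ∑ p ∈ Finset.Icc 1 n, c n p / f p
      = ∑ p ∈ Finset.range N, coeff n (oneSubExpNeg ^ (p + 1)) / f (p + 1) := by
  rw [← Finset.sum_subset (Finset.range_subset_range.mpr h), Finset.mul_sum,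
    ← Finset.Ico_add_one_right_eq_Icc, Finset.sum_Ico_eq_sum_range]
  · refine Finset.sum_congr rfl fun p _ => ?_
    rw [coeff_oneSubExpNeg_pow hn, add_comm 1 p, mul_div_assoc]
  · intro p _ hp
    rw [coeff_oneSubExpNeg_pow_of_lt (by simp at hp; omega), zero_div]

open PowerSeries in
theorem sum_bernoulli_mul_coeff_oneSubExpNeg_pow (j p : ℕ) :
    ∑ m ∈ Finset.range (j + 1), ((-1 : ℚ) ^ m * bernoulli m / (m.factorial : ℚ)) *
        coeff (j + 1 - m) (oneSubExpNeg ^ (p + 1)) = coeff j (oneSubExpNeg ^ p) := by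
  have h : X * oneSubExpNeg ^ p = bernoulli'PowerSeries ℚ * oneSubExpNeg ^ (p + 1) := by
    rw [pow_succ', ← mul_assoc, bernoulli'PowerSeries_mul_oneSubExpNeg]
  rw [← coeff_succ_X_mul, h, coeff_mul, Finset.Nat.sum_antidiagonal_eq_sum_range_succ_mk,
    Finset.sum_range_succ _ (j + 1), Nat.sub_self, coeff_oneSubExpNeg_pow_of_lt p.succ_pos,
    mul_zero, add_zero]
  refine Finset.sum_congr rfl fun m _ => ?_
  simp [bernoulli'PowerSeries, bernoulli'_eq_bernoulli]

/-- For all integers `i ≥ 2` and `j ≥ 1`,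
`∑_{m=0}^{j} ((-1)^m B_m / m!) * ((-1)^(j+1-m)/(j+1-m)!) * ∑_{p=1}^{j+1-m} c (j+1-m) p / (i-1+p)`
equals `((-1)^j / j!) * ∑_{p=1}^{j} c j p / (i+p)`. Here `bernoulli` is Mathlib's Bernoulli
number with EGF `t/(e^t - 1)` (so `bernoulli 1 = -1/2`). -/
theorem bernoulli_c_sum_identity (i j : ℕ) (hi : 2 ≤ i) (hj : 1 ≤ j) :
    ∑ m ∈ Finset.range (j + 1),
        ((-1 : ℚ) ^ m * bernoulli m / (Nat.factorial m : ℚ)) *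
          ((-1 : ℚ) ^ (j + 1 - m) / (Nat.factorial (j + 1 - m) : ℚ)) *
            ∑ p ∈ Finset.Icc 1 (j + 1 - m), c (j + 1 - m) p / ((i : ℚ) - 1 + (p : ℚ))
      = ((-1 : ℚ) ^ j / (Nat.factorial j : ℚ)) *
          ∑ p ∈ Finset.Icc 1 j, c j p / ((i : ℚ) + (p : ℚ)) := by
  rw [sum_c_div_eq_sum_coeff (by omega) le_rfl (fun p => (i : ℚ) + p)]
  calc _ = ∑ m ∈ Finset.range (j + 1), ∑ p ∈ Finset.range (j + 1),
        ((-1 : ℚ) ^ m * bernoulli m / (Nat.factorial m : ℚ)) *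
          PowerSeries.coeff (j + 1 - m) (oneSubExpNeg ^ (p + 1)) / ((i : ℚ) + p) := by
        refine Finset.sum_congr rfl fun m hm => ?_
        have hm' := Finset.mem_range.mp hm
        rw [mul_assoc, sum_c_div_eq_sum_coeff (N := j + 1) (by omega) (by omega)
          (fun p => (i : ℚ) - 1 + p), Finset.mul_sum]
        refine Finset.sum_congr rfl fun p _ => ?_
        push_cast
        rw [show (i : ℚ) - 1 + (p + 1) = i + p by ring, ← mul_div_assoc]
    _ = ∑ p ∈ Finset.range (j + 1), PowerSeries.coeff j (oneSubExpNeg ^ p) / ((i : ℚ) + p) := by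
        rw [Finset.sum_comm]
        refine Finset.sum_congr rfl fun p _ => ?_
        rw [← Finset.sum_div, sum_bernoulli_mul_coeff_oneSubExpNeg_pow]
    _ = _ := by
        rw [Finset.sum_range_succ']
        simp [PowerSeries.coeff_one, show j ≠ 0 by omega]
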